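/- Let W be a random n×m complex matrix with h(W) > −∞ and E[‖W‖_F²] < ∞, and let A be a deterministic m×t complex matrix of full column rank (t ≤ m) with SVD A = U Σ V. Then the differential entropy of W·A satisfies h(W A) = n·log det(A^H A) + h(W'), where W' consists of the first t columns of W U; moreover −∞ < h(W') < ∞. -/

import Mathlib

open MeasureTheory Matrix

/-- Matrices over `ℂ` carry the entrywise (Lebesgue product) measure structure. -/
noncomputable instance matrixMeasureSpace (a b : ℕ) :
    MeasureSpace (Matrix (Fin a) (Fin b) ℂ) := by
  unfold Matrix; infer_instance

open scoped ENNReal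

lemma aux_pos {g f q b : ℝ} (hg : 0 ≤ g) (hf : 0 ≤ f) (hb : 0 ≤ b) (hq : q = Real.exp (-b)) :
    g * max (Real.log f) 0 ≤ g * max (Real.log g) 0 + g * b + f * q := by
  have hq0 : 0 < q := hq ▸ Real.exp_pos _
  have hlq : Real.log q = -b := by rw [hq, Real.log_exp]
  have h0 : 0 ≤ g * max (Real.log g) 0 := mul_nonneg hg (le_max_right _ _)
  have h1 : 0 ≤ g * b := mul_nonneg hg hb
  have h2 : 0 ≤ f * q := mul_nonneg hf hq0.le
  rcases le_total (Real.log f) 0 with h | h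
  · rw [max_eq_right h]; linarith
  rw [max_eq_left h]
  rcases hg.eq_or_lt with rfl | hg'
  · simp; exact h2
  rcases hf.eq_or_lt with rfl | hf'
  · simp; linarith
  have h3 : Real.log (f * q / g) ≤ f * q / g - 1 := Real.log_le_sub_one_of_pos (by positivity)
  rw [Real.log_div (by positivity) (by positivity), Real.log_mul (by positivity) (by positivity), hlq] at h3
  have h4 := mul_le_mul_of_nonneg_left h3 hg
  have h5 : g * (f * q / g - 1) = f * q - g := by field_simp
  have h6 : g * Real.log g ≤ g * max (Real.log g) 0 := mul_le_mul_of_nonneg_left (le_max_left _ _) hg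
  nlinarith

lemma aux_neg {f a : ℝ} (hf : 0 ≤ f) (ha : 0 ≤ a) :
    f * max (-Real.log f) 0 ≤ f * a + Real.exp (-a) := by
  have h1 : 0 ≤ f * a := mul_nonneg hf ha
  have he := Real.exp_pos (-a)
  rcases le_total (-Real.log f) 0 with h | h
  · rw [max_eq_right h]; linarith
  rw [max_eq_left h]
  rcases hf.eq_or_lt with rfl | hf'
  · simp; exact he.le
  have h3 : Real.log (Real.exp (-a) / f) ≤ Real.exp (-a) / f - 1 :=
    Real.log_le_sub_one_of_pos (by positivity)
  rw [Real.log_div (by positivity) (by positivity), Real.log_exp] at h3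
  have h4 := mul_le_mul_of_nonneg_left h3 hf
  have h5 : f * (Real.exp (-a) / f - 1) = Real.exp (-a) - f := by field_simp
  nlinarith

lemma ofReal_max0 (x : ℝ) : ENNReal.ofReal (max x 0) = ENNReal.ofReal x := by
  rw [ENNReal.ofReal, Real.toNNReal, ENNReal.ofReal, Real.toNNReal]; congr 2; simp

lemma core {α β : Type*} [MeasurableSpace α] [MeasurableSpace β] (ν1 : Measure α) (ν2 : Measure β)
    [SFinite ν1] [SFinite ν2] (G : α × β → ℝ≥0∞) (hG : Measurable G) (hGt : ∀ p, G p ≠ ⊤)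
    (ρ : Measure (α × β)) [IsProbabilityMeasure ρ] (hρ : ρ = (ν1.prod ν2).withDensity G)
    (a : α → ℝ) (ham : Measurable a) (ha0 : ∀ x, 0 ≤ a x)
    (b : β → ℝ) (hbm : Measurable b) (hb0 : ∀ x, 0 ≤ b x)
    (hae : ∫⁻ x, ENNReal.ofReal (Real.exp (-a x)) ∂ν1 < ⊤)
    (hbe : ∫⁻ x, ENNReal.ofReal (Real.exp (-b x)) ∂ν2 < ⊤)
    (hai : ∫⁻ p, ENNReal.ofReal (a p.1) ∂ρ < ⊤)
    (hbi : ∫⁻ p, ENNReal.ofReal (b p.2) ∂ρ < ⊤)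
    (hent : ∫⁻ p, ENNReal.ofReal (Real.log (G p).toReal) ∂ρ < ⊤) :
    ∃ f : α → ℝ, Measurable f ∧ (∀ x, 0 ≤ f x) ∧
      ρ.map Prod.fst = ν1.withDensity (fun x => ENNReal.ofReal (f x)) ∧
      Integrable (fun x => Real.log (f x)) (ρ.map Prod.fst) := by
  set F : α → ℝ≥0∞ := fun y => ∫⁻ z, G (y, z) ∂ν2 with hF
  have hFm : Measurable F := hG.lintegral_prod_right'
  have hFint : ∫⁻ y, F y ∂ν1 = 1 := by
    rw [hF, ← lintegral_prod _ hG.aemeasurable, ← setLIntegral_univ, ← withDensity_apply _ .univ, ← hρ]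
    simp
  have hFfin : ∀ᵐ y ∂ν1, F y < ⊤ := ae_lt_top hFm (by simp [hFint])
  set f : α → ℝ := fun y => (F y).toReal with hf
  have hfm : Measurable f := hFm.ennreal_toReal
  have hf0 : ∀ x, 0 ≤ f x := fun x => ENNReal.toReal_nonneg
  have hfle : ∀ x, ENNReal.ofReal (f x) ≤ F x := fun x => ENNReal.ofReal_toReal_le
  have hmap : ρ.map Prod.fst = ν1.withDensity (fun x => ENNReal.ofReal (f x)) := by
    have : (fun x => ENNReal.ofReal (f x)) =ᵐ[ν1] F := by
      filter_upwards [hFfin] with y hy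
      exact ENNReal.ofReal_toReal hy.ne
    rw [withDensity_congr_ae this]
    ext s hs
    rw [Measure.map_apply measurable_fst hs, withDensity_apply _ hs, hρ,
      withDensity_apply _ (measurable_fst hs), ← Set.prod_univ, setLIntegral_prod _ hG.aemeasurable]
    simp [hF]
  refine ⟨f, hfm, hf0, hmap, ⟨(Real.measurable_log.comp hfm).aestronglyMeasurable, ?_⟩⟩
  have hlfm : Measurable fun x => Real.log (f x) := Real.measurable_log.comp hfm
  have hsplit : ∀ x : ℝ, ‖x‖ₑ = ENNReal.ofReal x + ENNReal.ofReal (-x) := by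
    intro x
    rw [Real.enorm_eq_ofReal_abs]
    rcases le_total 0 x with h | h
    · rw [abs_of_nonneg h, ENNReal.ofReal_of_nonpos (neg_nonpos.2 h), add_zero]
    · rw [abs_of_nonpos h, ENNReal.ofReal_of_nonpos h, zero_add]
  rw [HasFiniteIntegral]
  simp_rw [hsplit]
  rw [lintegral_add_left hlfm.ennreal_ofReal, ENNReal.add_lt_top]
  constructor
  · rw [lintegral_map hlfm.ennreal_ofReal measurable_fst, hρ, lintegral_withDensity_eq_lintegral_mul _ hG
      (show Measurable fun p : α × β => ENNReal.ofReal (Real.log (f p.1)) from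
        hlfm.ennreal_ofReal.comp measurable_fst)]
    rw [hρ, lintegral_withDensity_eq_lintegral_mul _ hG
      (show Measurable fun p => ENNReal.ofReal (Real.log (G p).toReal) from
        (Real.measurable_log.comp hG.ennreal_toReal).ennreal_ofReal)] at hent
    rw [hρ, lintegral_withDensity_eq_lintegral_mul _ hG
      (show Measurable fun p : α × β => ENNReal.ofReal (b p.2) from
        (hbm.comp measurable_snd).ennreal_ofReal)] at hbi
    refine lt_of_le_of_lt (lintegral_mono (g := fun p => (G p * ENNReal.ofReal (Real.log (G p).toReal) +
      G p * ENNReal.ofReal (b p.2)) + F p.1 * ENNReal.ofReal (Real.exp (-b p.2))) ?_) ?_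
    · intro p
      have h := ENNReal.ofReal_le_ofReal (aux_pos (ENNReal.toReal_nonneg (a := G p)) (hf0 p.1) (hb0 p.2) rfl)
      have hg0 := ENNReal.toReal_nonneg (a := G p)
      have hm := fun x : ℝ => le_max_right x 0
      rw [ENNReal.ofReal_add (add_nonneg (mul_nonneg hg0 (hm _)) (mul_nonneg hg0 (hb0 _)))
        (mul_nonneg (hf0 _) (Real.exp_pos _).le), 
        ENNReal.ofReal_add (mul_nonneg hg0 (hm _)) (mul_nonneg hg0 (hb0 _)),
        ENNReal.ofReal_mul hg0, ENNReal.ofReal_mul hg0, ENNReal.ofReal_mul hg0,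
        ENNReal.ofReal_mul (hf0 _), ofReal_max0, ofReal_max0, ENNReal.ofReal_toReal (hGt p)] at h
      refine h.trans ?_
      exact add_le_add le_rfl (mul_le_mul_left (hfle _) _)
    · rw [lintegral_add_right _ (by fun_prop), lintegral_add_right _ (by fun_prop), ENNReal.add_lt_top,
        ENNReal.add_lt_top]
      refine ⟨⟨hent, hbi⟩, ?_⟩
      rw [lintegral_prod_mul (g := fun z => ENNReal.ofReal (Real.exp (-b z))) hFm.aemeasurable
        (by fun_prop), hFint, one_mul]
      exact hbe
  · have hai' : ∫⁻ x, ENNReal.ofReal (a x) ∂(ρ.map Prod.fst) < ⊤ := by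
      rwa [lintegral_map ham.ennreal_ofReal measurable_fst]
    rw [hmap, lintegral_withDensity_eq_lintegral_mul _ hfm.ennreal_ofReal ham.ennreal_ofReal] at hai'
    rw [hmap, lintegral_withDensity_eq_lintegral_mul _ hfm.ennreal_ofReal
      (show Measurable fun x => ENNReal.ofReal (-Real.log (f x)) from hlfm.neg.ennreal_ofReal)]
    refine lt_of_le_of_lt (lintegral_mono (g := fun x => ENNReal.ofReal (f x) * ENNReal.ofReal (a x) +
      ENNReal.ofReal (Real.exp (-a x))) ?_) ?_
    · intro x
      have h := ENNReal.ofReal_le_ofReal (aux_neg (hf0 x) (ha0 x))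
      rwa [ENNReal.ofReal_add (mul_nonneg (hf0 _) (ha0 _)) (Real.exp_pos _).le,
        ENNReal.ofReal_mul (hf0 _), ENNReal.ofReal_mul (hf0 _), ofReal_max0] at h
    · rw [lintegral_add_right _ (by fun_prop), ENNReal.add_lt_top]
      exact ⟨hai', hae⟩

lemma map_equiv_withDensity {α β : Type*} [MeasurableSpace α] [MeasurableSpace β] (ν : Measure α)
    (e : α ≃ᵐ β) (g : α → ℝ≥0∞) :
    (ν.withDensity g).map e = (ν.map e).withDensity (fun y => g (e.symm y)) := by
  ext s hs
  rw [e.map_apply, withDensity_apply _ (e.measurable hs), withDensity_apply _ hs,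
    e.restrict_map, lintegral_map_equiv]
  simp

noncomputable def matR {n k l : ℕ} (B : Matrix (Fin k) (Fin l) ℂ) (x : Fin n → Fin k → ℂ) :
    Fin n → Fin l → ℂ := fun i => x i ᵥ* B

lemma matR_measurable {n k l : ℕ} (B : Matrix (Fin k) (Fin l) ℂ) :
    Measurable (matR (n := n) B) := by
  have : Continuous (matR (n := n) B) := by
    unfold matR Matrix.vecMul dotProduct; fun_prop
  exact this.measurable

lemma matR_mul {n k l r : ℕ} (B : Matrix (Fin k) (Fin l) ℂ) (C : Matrix (Fin l) (Fin r) ℂ)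
    (x : Fin n → Fin k → ℂ) : matR C (matR B x) = matR (B * C) x := by
  ext i; simp [matR]

noncomputable def matE (n : ℕ) {k : ℕ} (B : Matrix (Fin k) (Fin k) ℂ) (hB : IsUnit B.det) :
    (Fin n → Fin k → ℂ) ≃ᵐ (Fin n → Fin k → ℂ) where
  toFun := matR B
  invFun := matR B⁻¹
  left_inv x := by rw [matR_mul, Matrix.mul_nonsing_inv _ hB]; ext; simp [matR]
  right_inv x := by rw [matR_mul, Matrix.nonsing_inv_mul _ hB]; ext; simp [matR]
  measurable_toFun := matR_measurable _
  measurable_invFun := matR_measurable _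

lemma map_matE {n k : ℕ} (B : Matrix (Fin k) (Fin k) ℂ) (hB : IsUnit B.det) :
    (volume : Measure (Fin n → Fin k → ℂ)).map (matE n B hB) =
      ENNReal.ofReal ((‖B.det‖ ^ (2 * n))⁻¹) • volume := by
  let L : (Fin n → Fin k → ℂ) →ₗ[ℂ] (Fin n → Fin k → ℂ) :=
    LinearMap.pi (fun i => (Matrix.toLin' Bᵀ).comp (LinearMap.proj i))
  have hL : ⇑(matE n B hB) = ⇑(L.restrictScalars ℝ) := by
    ext x i j
    simp [matE, matR, L, Matrix.mulVec_transpose]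
  have hdet : LinearMap.det (L.restrictScalars ℝ) = ‖B.det‖ ^ (2 * n) := by
    rw [LinearMap.det_restrictScalars, Algebra.norm_complex_apply, LinearMap.det_pi]
    simp [Complex.normSq_eq_norm_sq, pow_mul, pow_right_comm]
  have hne : ‖B.det‖ ≠ 0 := by simpa using hB.ne_zero
  have h1 : (volume : Measure (Fin k → ℂ)).IsAddHaarMeasure := inferInstance
  have h2 : (volume : Measure (Fin n → Fin k → ℂ)).IsAddHaarMeasure :=
    Measure.pi.isAddHaarMeasure (fun _ => volume)
  rw [hL, Measure.map_linearMap_addHaar_eq_smul_addHaar _ (by rw [hdet]; positivity), hdet,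
    abs_of_nonneg (by positivity)]

noncomputable def splitRow (t r : ℕ) : (Fin (t + r) → ℂ) ≃ᵐ (Fin t → ℂ) × (Fin r → ℂ) :=
  (MeasurableEquiv.piCongrLeft (fun _ => ℂ) finSumFinEquiv).symm.trans
    (MeasurableEquiv.sumPiEquivProdPi (fun _ => ℂ))

lemma splitRow_mp (t r : ℕ) : MeasurePreserving (splitRow t r) volume volume := 
  (volume_measurePreserving_sumPiEquivProdPi (fun _ : Fin t ⊕ Fin r => ℂ)).comp
   (MeasurePreserving.symm _ (volume_measurePreserving_piCongrLeft (fun _ : Fin (t+r) => ℂ) finSumFinEquiv))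

noncomputable def splitE (n t r : ℕ) :
    (Fin n → Fin (t + r) → ℂ) ≃ᵐ (Fin n → Fin t → ℂ) × (Fin n → Fin r → ℂ) :=
  (MeasurableEquiv.piCongrRight (fun _ : Fin n => splitRow t r)).trans
    (MeasurableEquiv.arrowProdEquivProdArrow _ _ _)

lemma splitE_mp (n t r : ℕ) : MeasurePreserving (splitE n t r) volume volume :=
  haveI : SigmaFinite (volume : Measure ((Fin t → ℂ) × (Fin r → ℂ))) := by
    rw [Measure.volume_eq_prod]; infer_instance
  (volume_measurePreserving_arrowProdEquivProdArrow _ _ _).comp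
    (volume_preserving_pi (fun _ => splitRow_mp t r))

lemma splitE_fst {n t r : ℕ} (x : Fin n → Fin (t + r) → ℂ) (i j) :
    (splitE n t r x).1 i j = x i (Fin.castAdd r j) := by
  rfl
lemma splitE_snd {n t r : ℕ} (x : Fin n → Fin (t + r) → ℂ) (i j) :
    (splitE n t r x).2 i j = x i (Fin.natAdd t j) := by
  rfl

noncomputable def frob {n k : ℕ} (x : Fin n → Fin k → ℂ) : ℝ := ∑ i, ∑ j, ‖x i j‖ ^ 2

lemma frob_meas {n k : ℕ} : Measurable (frob (n := n) (k := k)) := by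
  unfold frob; fun_prop

lemma frob_nonneg {n k : ℕ} (x : Fin n → Fin k → ℂ) : 0 ≤ frob x := by
  unfold frob; positivity

lemma frob_exp (n k : ℕ) : ∫⁻ x : Fin n → Fin k → ℂ, ENNReal.ofReal (Real.exp (-frob x)) < ⊤ := by
  have h0 : Integrable (fun z : ℂ => Real.exp (-‖z‖ ^ 2)) := by
    by_contra h
    have h1 := Complex.integral_exp_neg_rpow (p := 2) (by norm_num)
    simp only [Real.rpow_ofNat] at h1
    rw [integral_undef h] at h1
    have : 0 < Real.Gamma (2 / 2 + 1) := Real.Gamma_pos_of_pos (by norm_num)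
    have := Real.pi_pos
    have : 0 < Real.pi * Real.Gamma (2 / 2 + 1) := by positivity
    linarith
  have h1 : Integrable (fun x : Fin k → ℂ => ∏ j, Real.exp (-‖x j‖ ^ 2)) :=
    Integrable.fintype_prod (fun _ => h0)
  have h2 : Integrable (fun x : Fin n → Fin k → ℂ => ∏ i, ∏ j, Real.exp (-‖x i j‖ ^ 2)) :=
    Integrable.fintype_prod (fun _ => h1)
  have : (fun x : Fin n → Fin k → ℂ => ∏ i, ∏ j, Real.exp (-‖x i j‖ ^ 2)) = fun x => Real.exp (-frob x) := by
    ext x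
    simp [frob, ← Real.exp_sum]
  rw [this] at h2
  exact h2.lintegral_lt_top

lemma frob_unitary {n k : ℕ} (U : Matrix (Fin k) (Fin k) ℂ) (hU : U ∈ Matrix.unitaryGroup (Fin k) ℂ)
    (x : Fin n → Fin k → ℂ) : frob (matR U x) = frob x := by
  unfold frob
  refine Finset.sum_congr rfl fun i _ => ?_
  have key : ∀ y : Fin k → ℂ, ((∑ j, ‖y j‖ ^ 2 : ℝ) : ℂ) = y ⬝ᵥ star y := by
    intro y
    simp [dotProduct, Complex.mul_conj, Complex.normSq_eq_norm_sq]
  have : (matR U x i) ⬝ᵥ star (matR U x i) = x i ⬝ᵥ star (x i) := by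
    simp only [matR]
    rw [Matrix.star_vecMul, Matrix.dotProduct_mulVec, Matrix.vecMul_vecMul, 
      ← Matrix.star_eq_conjTranspose, Matrix.mem_unitaryGroup_iff.1 hU, Matrix.vecMul_one]
  rw [← key, ← key] at this
  exact_mod_cast this

lemma frob_split {n t r : ℕ} (x : Fin n → Fin (t + r) → ℂ) :
    frob x = frob (splitE n t r x).1 + frob (splitE n t r x).2 := by
  simp only [frob, splitE_fst, splitE_snd, Fin.sum_univ_add, Finset.sum_add_distrib]

lemma ofReal_log_mono {u v : ℝ} (h0 : 0 ≤ u) (h : u ≤ v) :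
    ENNReal.ofReal (Real.log u) ≤ ENNReal.ofReal (Real.logb 2 v) := by
  rcases le_total u 1 with h1 | h1
  · rw [ENNReal.ofReal_of_nonpos (Real.log_nonpos h0 h1)]; exact zero_le
  · refine ENNReal.ofReal_le_ofReal ((Real.log_le_log (by linarith) h).trans ?_)
    rw [Real.logb, le_div_iff₀ (Real.log_pos (by norm_num))]
    have h3 : Real.log 2 ≤ 1 := by
      have := Real.log_le_sub_one_of_pos (x := 2) (by norm_num); linarith
    have h4 : 0 ≤ Real.log v := Real.log_nonneg (by linarith)
    nlinarith

lemma core2 (n t r : ℕ) (P : Measure (Fin n → Fin (t + r) → ℂ)) [IsProbabilityMeasure P]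
    (fW : (Fin n → Fin (t + r) → ℂ) → ℝ) (hfW0 : ∀ x, 0 ≤ fW x)
    (hdens : P = volume.withDensity fun x => ENNReal.ofReal (fW x))
    (hent : ∫⁻ x, ENNReal.ofReal (Real.logb 2 (fW x)) ∂P < ⊤)
    (hpow : ∫⁻ x, ENNReal.ofReal (frob x) ∂P < ⊤)
    (U : Matrix (Fin (t + r)) (Fin (t + r)) ℂ) (hU : U ∈ Matrix.unitaryGroup (Fin (t + r)) ℂ) :
    ∃ f : (Fin n → Fin t → ℂ) → ℝ, Measurable f ∧ (∀ x, 0 ≤ f x) ∧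
      P.map (fun x i j => matR U x i (Fin.castAdd r j)) =
        volume.withDensity (fun x => ENNReal.ofReal (f x)) ∧
      Integrable (fun x => Real.log (f x)) (P.map (fun x i j => matR U x i (Fin.castAdd r j))) := by
  obtain ⟨g, hgm, hgle, hgeq⟩ := exists_measurable_le_withDensity_eq
    (volume : Measure (Fin n → Fin (t + r) → ℂ)) (fun x => ENNReal.ofReal (fW x))
  rw [← hgeq] at hdens
  have hgt : ∀ x, g x ≠ ⊤ := fun x => ((hgle x).trans_lt ENNReal.ofReal_lt_top).ne
  have hent' : ∫⁻ x, ENNReal.ofReal (Real.log (g x).toReal) ∂P < ⊤ := by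
    refine lt_of_le_of_lt (lintegral_mono fun x => ?_) hent
    exact ofReal_log_mono ENNReal.toReal_nonneg (ENNReal.toReal_le_of_le_ofReal (hfW0 x) (hgle x))
  have hdn : ‖U.det‖ = 1 := by
    have := Matrix.det_of_mem_unitary hU
    exact CStarRing.norm_of_mem_unitary this
  have hUu : IsUnit U.det := by
    rw [isUnit_iff_ne_zero]; intro h; rw [h] at hdn; simp at hdn
  let e := (matE n U hUu).trans (splitE n t r)
  have hemap : (volume : Measure (Fin n → Fin (t + r) → ℂ)).map e = volume.prod volume := by
    have h1 : (volume : Measure (Fin n → Fin (t + r) → ℂ)).map (matE n U hUu) = volume := by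
      rw [map_matE, hdn]; simp
    have : (volume : Measure (Fin n → Fin (t + r) → ℂ)).map e =
        ((volume : Measure (Fin n → Fin (t + r) → ℂ)).map (matE n U hUu)).map (splitE n t r) := by
      rw [Measure.map_map (splitE n t r).measurable (matE n U hUu).measurable]; rfl
    rw [this, h1, (splitE_mp n t r).map_eq]; rfl
  have hefrob : ∀ x, frob (e x).1 + frob (e x).2 = frob x := by
    intro x
    rw [← frob_unitary U hU x]
    exact (frob_split _).symm
  have : IsProbabilityMeasure (P.map e) := Measure.isProbabilityMeasure_map e.measurable.aemeasurable
  obtain ⟨f, hfm, hf0, hfd, hfi⟩ := core (volume : Measure (Fin n → Fin t → ℂ))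
    (volume : Measure (Fin n → Fin r → ℂ)) (fun p => g (e.symm p)) (hgm.comp e.symm.measurable)
    (fun p => hgt _) (P.map e) (by
      conv_lhs => rw [hdens]
      rw [map_equiv_withDensity, hemap])
    frob frob_meas frob_nonneg frob frob_meas frob_nonneg (frob_exp _ _) (frob_exp _ _)
    (by
      rw [lintegral_map_equiv]
      refine lt_of_le_of_lt (lintegral_mono fun x => ENNReal.ofReal_le_ofReal ?_) hpow
      have := hefrob x
      have := frob_nonneg (e x).2
      linarith)
    (by
      rw [lintegral_map_equiv]
      refine lt_of_le_of_lt (lintegral_mono fun x => ENNReal.ofReal_le_ofReal ?_) hpow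
      have := hefrob x
      have := frob_nonneg (e x).1
      linarith)
    (by
      rw [lintegral_map_equiv]
      simpa using hent')
  have hmm : (P.map e).map Prod.fst = P.map (fun x i j => matR U x i (Fin.castAdd r j)) := by
    rw [Measure.map_map measurable_fst e.measurable]; rfl
  rw [hmm] at hfd hfi
  exact ⟨f, hfm, hf0, hfd, hfi⟩

lemma core3 (n t : ℕ) (Q : Measure (Fin n → Fin t → ℂ)) [IsProbabilityMeasure Q]
    (f : (Fin n → Fin t → ℂ) → ℝ) (hfm : Measurable f) (hf0 : ∀ x, 0 ≤ f x)
    (hQ : Q = volume.withDensity (fun x => ENNReal.ofReal (f x)))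
    (hi : Integrable (fun x => Real.logb 2 (f x)) Q)
    (B : Matrix (Fin t) (Fin t) ℂ) (hB : IsUnit B.det) :
    ∃ fA : (Fin n → Fin t → ℂ) → ℝ, (∀ x, 0 ≤ fA x) ∧
      Q.map (matR B) = volume.withDensity (fun x => ENNReal.ofReal (fA x)) ∧
      Integrable (fun x => Real.logb 2 (fA x)) (Q.map (matR B)) ∧
      (-∫ x, Real.logb 2 (fA x) ∂(Q.map (matR B))) =
        n * Real.logb 2 (‖B.det‖ ^ 2) + (-∫ x, Real.logb 2 (f x) ∂Q) := by
  let e := matE n B hB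
  have hd : 0 < ‖B.det‖ := by simpa using hB.ne_zero
  set c : ℝ := (‖B.det‖ ^ (2 * n))⁻¹ with hc
  have hc0 : 0 < c := by positivity
  have he : (matR B : (Fin n → Fin t → ℂ) → _) = e := rfl
  have hlc : Real.logb 2 c = - (n * Real.logb 2 (‖B.det‖ ^ 2)) := by
    rw [hc, Real.logb_inv, pow_mul, Real.logb_pow]
  have hpos : ∀ᵐ x ∂Q, 0 < f x := by
    rw [hQ, ae_withDensity_iff hfm.ennreal_ofReal]
    refine Filter.Eventually.of_forall fun x hx => ?_
    by_contra h
    exact hx (ENNReal.ofReal_of_nonpos (not_lt.1 h))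
  have hae : (fun x => Real.logb 2 (c * f x)) =ᵐ[Q]
      fun x => Real.logb 2 (f x) + (- (n * Real.logb 2 (‖B.det‖ ^ 2))) := by
    filter_upwards [hpos] with x hx
    rw [Real.logb_mul hc0.ne' hx.ne', hlc, add_comm]
  refine ⟨fun y => c * f (e.symm y), fun y => mul_nonneg hc0.le (hf0 _), ?_, ?_, ?_⟩
  · rw [he]
    conv_lhs => rw [hQ]
    rw [map_equiv_withDensity, map_matE, withDensity_smul_measure, ← withDensity_smul]
    · congr 1
      ext y
      simp [ENNReal.ofReal_mul hc0.le, hc, e]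
    · exact (hfm.comp e.symm.measurable).ennreal_ofReal
  · rw [he, integrable_map_equiv]
    refine (integrable_congr ?_).2 (hi.add (integrable_const (- (n * Real.logb 2 (‖B.det‖ ^ 2)))))
    simp only [Function.comp_def, MeasurableEquiv.symm_apply_apply]
    exact hae
  · rw [he, integral_map_equiv]
    simp only [MeasurableEquiv.symm_apply_apply]
    rw [integral_congr_ae hae, integral_add hi (integrable_const _)]
    simp only [integral_const, probReal_univ, one_smul]
    ring

/-- Entropy lemma: let `W` be a random `n × m` complex matrix with density `fW` (w.r.t.
Lebesgue measure), `h(W) > −∞` and `E[‖W‖_F²] < ∞`; let `A = U Σ V` be an `m × t` matrix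
of full column rank (`t ≤ m`) with `U, V` unitary and `Σ` rectangular diagonal, and let
`W'` be the first `t` columns of `W U`. Then `W A` and `W'` admit densities `fWA, fW'`,
the differential entropy (base 2) `h(W')` is finite, and
`h(W A) = n · log₂ det(Aᴴ A) + h(W')`, where `h(V) = −∫ log₂ f_V dP_V`. -/
theorem stmt_18 (n m t : ℕ) (ht : 0 < t) (htm : t ≤ m)
    {Ω : Type*} [MeasurableSpace Ω] (μ : Measure Ω) [IsProbabilityMeasure μ]
    (W : Ω → Matrix (Fin n) (Fin m) ℂ) (hWm : Measurable W)
    (A : Matrix (Fin m) (Fin t) ℂ) (hArank : A.rank = t)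
    (U : Matrix (Fin m) (Fin m) ℂ) (S : Matrix (Fin m) (Fin t) ℂ)
    (V : Matrix (Fin t) (Fin t) ℂ)
    (hU : U ∈ Matrix.unitaryGroup (Fin m) ℂ) (hV : V ∈ Matrix.unitaryGroup (Fin t) ℂ)
    (hS : ∀ (i : Fin m) (j : Fin t), (i : ℕ) ≠ (j : ℕ) → S i j = 0)
    (hSVD : A = U * S * V)
    (fW : Matrix (Fin n) (Fin m) ℂ → ℝ) (hfW0 : ∀ x, 0 ≤ fW x)
    (hWdens : μ.map W = volume.withDensity fun x => ENNReal.ofReal (fW x))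
    -- `h(W) > −∞`: the positive part of `log₂ fW` has finite integral
    (hent : ∫⁻ x, ENNReal.ofReal (Real.logb 2 (fW x)) ∂(μ.map W) < ⊤)
    -- `E[‖W‖_F²] < ∞`
    (hpow : Integrable (fun ω => ∑ i, ∑ j, ‖W ω i j‖ ^ 2) μ)
    (W' : Ω → Matrix (Fin n) (Fin t) ℂ)
    (hW' : ∀ ω, W' ω = (W ω * U).submatrix id (Fin.castLE htm)) :
    ∃ fWA : Matrix (Fin n) (Fin t) ℂ → ℝ, ∃ fW' : Matrix (Fin n) (Fin t) ℂ → ℝ,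
      (∀ x, 0 ≤ fWA x) ∧ (∀ x, 0 ≤ fW' x) ∧
      μ.map (fun ω => W ω * A) = volume.withDensity (fun x => ENNReal.ofReal (fWA x)) ∧
      μ.map W' = volume.withDensity (fun x => ENNReal.ofReal (fW' x)) ∧
      Integrable (fun x => Real.logb 2 (fW' x)) (μ.map W') ∧
      Integrable (fun x => Real.logb 2 (fWA x)) (μ.map (fun ω => W ω * A)) ∧
      (-∫ x, Real.logb 2 (fWA x) ∂(μ.map (fun ω => W ω * A))) =
        n * Real.logb 2 ((Aᴴ * A).det).re +
          (-∫ x, Real.logb 2 (fW' x) ∂(μ.map W')) := by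
  obtain ⟨r, rfl⟩ := Nat.exists_eq_add_of_le htm
  -- reduction to the top block
  set B : Matrix (Fin t) (Fin t) ℂ := S.submatrix (Fin.castAdd r) id * V with hBdef
  have hT : ∀ k j, (S * V) (Fin.castAdd r k) j = B k j := fun k j => rfl
  clear_value B
  have hZ : ∀ k j, (S * V) (Fin.natAdd t k) j = 0 := by
    intro k j
    rw [Matrix.mul_apply]
    refine Finset.sum_eq_zero fun l _ => ?_
    rw [hS _ _ (by simp; omega), zero_mul]
  have hAA : Aᴴ * A = Bᴴ * B := by
    have h1 : Aᴴ * A = (S * V)ᴴ * (S * V) := by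
      rw [hSVD, Matrix.mul_assoc U, Matrix.conjTranspose_mul U, Matrix.mul_assoc,
        ← Matrix.mul_assoc Uᴴ, ← Matrix.star_eq_conjTranspose U, Matrix.mem_unitaryGroup_iff'.1 hU,
        Matrix.one_mul]
    rw [h1]
    generalize S * V = C at hT hZ
    ext i j
    simp [Matrix.mul_apply, Fin.sum_univ_add, hT, hZ]
  open scoped ComplexOrder in
  have hBrank : B.rank = t := by
    rw [← Matrix.rank_conjTranspose_mul_self, ← hAA, Matrix.rank_conjTranspose_mul_self, hArank]
  have hB : IsUnit B.det := by
    rw [← Matrix.isUnit_iff_isUnit_det, ← Matrix.mulVec_surjective_iff_isUnit]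
    have h1 : LinearMap.range B.mulVecLin = ⊤ := by
      apply Submodule.eq_top_of_finrank_eq
      rw [show Module.finrank ℂ (LinearMap.range B.mulVecLin) = t from hBrank]
      simp
    exact LinearMap.range_eq_top.1 h1
  have hdet : ((Aᴴ * A).det).re = ‖B.det‖ ^ 2 := by
    rw [hAA, Matrix.det_mul, Matrix.det_conjTranspose]
    have : star B.det * B.det = ((‖B.det‖ ^ 2 : ℝ) : ℂ) := by
      rw [Complex.star_def, ← Complex.normSq_eq_conj_mul_self, Complex.normSq_eq_norm_sq]
    rw [this, Complex.ofReal_re]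
  -- the laws
  let Wp : Ω → (Fin n → Fin (t + r) → ℂ) := W
  have hWp : Measurable Wp := hWm
  let P : Measure (Fin n → Fin (t + r) → ℂ) := μ.map Wp
  have : IsProbabilityMeasure P := Measure.isProbabilityMeasure_map hWp.aemeasurable
  have hpow' : ∫⁻ x, ENNReal.ofReal (frob x) ∂P < ⊤ := by
    rw [lintegral_map frob_meas.ennreal_ofReal hWp]
    exact hpow.lintegral_lt_top
  obtain ⟨f, hfm, hf0, hfd, hfi⟩ := core2 n t r P fW hfW0 hWdens hent hpow' U hU
  have hcm : Measurable (fun (x : Fin n → Fin (t + r) → ℂ) (i : Fin n) (j : Fin t) =>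
      matR U x i (Fin.castAdd r j)) := by
    have := matR_measurable (n := n) U
    fun_prop
  have hWeq : μ.map W' = P.map (fun x i j => matR U x i (Fin.castAdd r j)) := by
    rw [Measure.map_map hcm hWp]
    have : W' = ((fun (x : Fin n → Fin (t + r) → ℂ) (i : Fin n) (j : Fin t) =>
      matR U x i (Fin.castAdd r j)) ∘ Wp) := by
      funext ω; rw [hW']; rfl
    rw [this]; rfl
  have hcomp : ∀ x : Fin n → Fin (t + r) → ℂ,
      matR B (fun i j => matR U x i (Fin.castAdd r j)) = matR A x := by
    intro x
    rw [hSVD, Matrix.mul_assoc, ← matR_mul U (S * V) x]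
    generalize matR U x = y
    ext i j
    simp only [matR, Matrix.vecMul, dotProduct, Fin.sum_univ_add, hT, hZ]
    simp
  set Q := P.map (fun x i j => matR U x i (Fin.castAdd r j)) with hQ
  have : IsProbabilityMeasure Q := Measure.isProbabilityMeasure_map hcm.aemeasurable
  have hWAeq : μ.map (fun ω => W ω * A) = Q.map (matR B) := by
    rw [hQ, Measure.map_map (matR_measurable B) hcm, Measure.map_map ((matR_measurable B).comp hcm) hWp]
    have : (fun ω => W ω * A) = (matR B ∘ (fun (x : Fin n → Fin (t + r) → ℂ) (i : Fin n) (j : Fin t) =>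
      matR U x i (Fin.castAdd r j))) ∘ Wp := by
      funext ω
      exact (hcomp (Wp ω)).symm
    rw [this]; rfl
  have hfi2 : Integrable (fun x => Real.logb 2 (f x)) Q := hfi.div_const _
  obtain ⟨fA, hA0, hAd, hAi, hAe⟩ := core3 n t Q f hfm hf0 hfd hfi2 B hB
  refine ⟨fA, f, hA0, hf0, ?_⟩
  rw [hWeq, hWAeq, hdet]
  exact ⟨hAd, hfd, hfi2, hAi, hAe⟩
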